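/- arXiv:2207.07523 — 2 statements merged into one kernel-verified Lean document; each statement's English description precedes it below -/
import Mathlib

section
/- There exist absolute constants 0 < c < C such that for every natural number n one can find an n × n matrix V all of whose entries are +1 or −1 satisfying c·√n ≤ s_min(V) ≤ s_max(V) ≤ C·√n. (In particular, ±1-valued matrices with condition number bounded by an absolute constant — 'approximately Hadamard matrices' — exist in every dimension.) -/
open MeasureTheory Matrix

/-- The largest singular value of an `n × N` real matrix, i.e. the operator norm of the
induced linear map between Euclidean spaces. -/
noncomputable def sMax {n N : ℕ} (A : Matrix (Fin n) (Fin N) ℝ) : ℝ :=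
  ‖LinearMap.toContinuousLinearMap (Matrix.toEuclideanLin A)‖

/-- The smallest singular value of an `n × N` real matrix (`n ≤ N`), i.e.
`√λ_min(AAᵀ) = min_{‖x‖₂ = 1} ‖Aᵀ x‖₂`. -/
noncomputable def sMin {n N : ℕ} (A : Matrix (Fin n) (Fin N) ℝ) : ℝ :=
  ⨅ x : {x : EuclideanSpace ℝ (Fin n) // ‖x‖ = 1},
    ‖Matrix.toEuclideanLin Aᵀ (x : EuclideanSpace ℝ (Fin n))‖

open scoped Kronecker

/-- Squared Euclidean length. -/
def nsq {ι : Type*} [Fintype ι] (x : ι → ℝ) : ℝ := ∑ a, x a ^ 2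

lemma nsq_mulVec {ι : Type*} [Fintype ι] [DecidableEq ι] (M : Matrix ι ι ℝ) (q : ℝ)
    (h : Mᵀ * M = q • (1 : Matrix ι ι ℝ)) (x : ι → ℝ) : nsq (M *ᵥ x) = q * nsq x := by
  have h1 : ∀ y : ι → ℝ, nsq y = y ⬝ᵥ y := by
    intro y; simp [nsq, dotProduct, sq]
  rw [h1, h1, Matrix.dotProduct_mulVec, ← Matrix.mulVec_transpose, Matrix.mulVec_mulVec, h,
    Matrix.smul_mulVec, Matrix.one_mulVec, smul_dotProduct, smul_eq_mul]

structure Triple (ι : Type) [Fintype ι] [DecidableEq ι] (s : ℝ) where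
  F : Matrix ι ι ℝ
  G : Matrix ι ι ℝ
  H : Matrix ι ι ℝ
  hF : ∀ i j, F i j = 1 ∨ F i j = -1
  hG : ∀ i j, G i j = 1 ∨ G i j = -1
  hH : ∀ i j, H i j = 1 ∨ H i j = -1
  FF : Fᵀ * F = (s ^ 2) • (1 : Matrix ι ι ℝ)
  FF' : F * Fᵀ = (s ^ 2) • (1 : Matrix ι ι ℝ)
  GG : Gᵀ * G = (s ^ 2) • (1 : Matrix ι ι ℝ)
  HH : Hᵀ * H = (s ^ 2) • (1 : Matrix ι ι ℝ)
  FH : Fᵀ * H = s • G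

lemma pm_mul {a b : ℝ} (ha : a = 1 ∨ a = -1) (hb : b = 1 ∨ b = -1) :
    a * b = 1 ∨ a * b = -1 := by
  rcases ha with rfl | rfl <;> rcases hb with rfl | rfl <;> norm_num

noncomputable def Triple.mul {ι κ : Type} [Fintype ι] [DecidableEq ι] [Fintype κ] [DecidableEq κ]
    {s t : ℝ} (T : Triple ι s) (U : Triple κ t) : Triple (ι × κ) (s * t) where
  F := T.F ⊗ₖ U.F
  G := T.G ⊗ₖ U.G
  H := T.H ⊗ₖ U.H
  hF := fun i j => pm_mul (T.hF _ _) (U.hF _ _)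
  hG := fun i j => pm_mul (T.hG _ _) (U.hG _ _)
  hH := fun i j => pm_mul (T.hH _ _) (U.hH _ _)
  FF := by
    rw [← Matrix.kroneckerMap_transpose, ← Matrix.mul_kronecker_mul, T.FF, U.FF,
      Matrix.smul_kronecker, Matrix.kronecker_smul, Matrix.one_kronecker_one, smul_smul, mul_pow]
  FF' := by
    rw [← Matrix.kroneckerMap_transpose, ← Matrix.mul_kronecker_mul, T.FF', U.FF',
      Matrix.smul_kronecker, Matrix.kronecker_smul, Matrix.one_kronecker_one, smul_smul, mul_pow]
  GG := by
    rw [← Matrix.kroneckerMap_transpose, ← Matrix.mul_kronecker_mul, T.GG, U.GG,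
      Matrix.smul_kronecker, Matrix.kronecker_smul, Matrix.one_kronecker_one, smul_smul, mul_pow]
  HH := by
    rw [← Matrix.kroneckerMap_transpose, ← Matrix.mul_kronecker_mul, T.HH, U.HH,
      Matrix.smul_kronecker, Matrix.kronecker_smul, Matrix.one_kronecker_one, smul_smul, mul_pow]
  FH := by
    rw [← Matrix.kroneckerMap_transpose, ← Matrix.mul_kronecker_mul, T.FH, U.FH,
      Matrix.smul_kronecker, Matrix.kronecker_smul, smul_smul]

noncomputable def triple4 : Triple (Fin 4) 2 where
  F := !![-1, 1, 1, 1; 1, -1, 1, 1; 1, 1, -1, 1; 1, 1, 1, -1]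
  G := !![1, 1, 1, 1; 1, -1, 1, -1; 1, 1, -1, -1; 1, -1, -1, 1]
  H := !![1, -1, -1, -1; 1, 1, -1, 1; 1, -1, 1, 1; 1, 1, 1, -1]
  hF := by intro i j; fin_cases i <;> fin_cases j <;> simp
  hG := by intro i j; fin_cases i <;> fin_cases j <;> simp
  hH := by intro i j; fin_cases i <;> fin_cases j <;> simp
  FF := by ext i j; fin_cases i <;> fin_cases j <;> simp [Matrix.mul_apply, Fin.sum_univ_four] <;> norm_num
  FF' := by ext i j; fin_cases i <;> fin_cases j <;> simp [Matrix.mul_apply, Fin.sum_univ_four] <;> norm_num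
  GG := by ext i j; fin_cases i <;> fin_cases j <;> simp [Matrix.mul_apply, Fin.sum_univ_four] <;> norm_num
  HH := by ext i j; fin_cases i <;> fin_cases j <;> simp [Matrix.mul_apply, Fin.sum_univ_four] <;> norm_num
  FH := by ext i j; fin_cases i <;> fin_cases j <;> simp [Matrix.mul_apply, Fin.sum_univ_four] <;> norm_num

noncomputable def triple1 : Triple (Fin 1) 1 where
  F := 1
  G := 1
  H := 1
  hF := by intro i j; fin_cases i; fin_cases j; simp
  hG := by intro i j; fin_cases i; fin_cases j; simp
  hH := by intro i j; fin_cases i; fin_cases j; simp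
  FF := by simp
  FF' := by simp
  GG := by simp
  HH := by simp
  FH := by simp

lemma exists_triple (k : ℕ) : ∃ (ι : Type) (_ : Fintype ι) (_ : DecidableEq ι),
    Fintype.card ι = 4 ^ k ∧ Nonempty (Triple ι (2 ^ k)) := by
  induction k with
  | zero => exact ⟨Fin 1, inferInstance, inferInstance, by simp, ⟨by simpa using triple1⟩⟩
  | succ k ih =>
    obtain ⟨ι, h1, h2, hc, ⟨T⟩⟩ := ih
    refine ⟨ι × Fin 4, inferInstance, inferInstance, by simp [hc, pow_succ], ⟨?_⟩⟩
    rw [pow_succ]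
    exact T.mul triple4

lemma nsq_nonneg {ι : Type*} [Fintype ι] (x : ι → ℝ) : 0 ≤ nsq x :=
  Finset.sum_nonneg fun _ _ => sq_nonneg _

lemma nsq_sum_le {ι : Type*} [Fintype ι] {m : ℕ} (x : Fin m → ι → ℝ) :
    nsq (∑ i, x i) ≤ m * ∑ i, nsq (x i) := by
  unfold nsq
  rw [Finset.sum_comm, Finset.mul_sum]
  refine Finset.sum_le_sum fun a _ => ?_
  have := sq_sum_le_card_mul_sum_sq (s := (Finset.univ : Finset (Fin m))) (f := fun i => x i a)
  simpa using this

lemma nsq_three {ι : Type*} [Fintype ι] (x y z w : ι → ℝ) (h : ∀ a, w a = x a + y a + z a) :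
    nsq w ≤ 3 * (nsq x + nsq y + nsq z) := by
  unfold nsq
  rw [← Finset.sum_add_distrib, ← Finset.sum_add_distrib, Finset.mul_sum]
  refine Finset.sum_le_sum fun a _ => ?_
  rw [h a]
  nlinarith [sq_nonneg (x a - y a), sq_nonneg (x a - z a), sq_nonneg (y a - z a)]

lemma nsq_two {ι : Type*} [Fintype ι] (x y w : ι → ℝ) (h : ∀ a, w a = x a + y a) :
    nsq w ≤ 2 * (nsq x + nsq y) := by
  unfold nsq
  rw [← Finset.sum_add_distrib, Finset.mul_sum]
  refine Finset.sum_le_sum fun a _ => ?_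
  rw [h a]
  nlinarith [sq_nonneg (x a - y a)]

lemma nsq_smul {ι : Type*} [Fintype ι] (c : ℝ) (x : ι → ℝ) : nsq (c • x) = c ^ 2 * nsq x := by
  simp [nsq, mul_pow, Finset.mul_sum]

set_option maxHeartbeats 1000000 in
lemma core_bounds {ι : Type} [Fintype ι] [DecidableEq ι] {s : ℝ} (hs : 0 < s) (T : Triple ι s)
    (m : ℕ) (hm : 3 ≤ m) (hm' : m ≤ 11) (S : Finset ι)
    (x : Fin m → ι → ℝ) (y : ι → ℝ) (hy : ∀ a, a ∉ S → y a = 0)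
    (u : Fin m → ι → ℝ) (v : ι → ℝ)
    (hu : ∀ i, u i = T.H *ᵥ (∑ j, x j) - (2 : ℝ) • (T.H *ᵥ x i) + T.F *ᵥ y)
    (hv : v = T.G *ᵥ (∑ j, x j) + T.H *ᵥ y) :
    s ^ 2 * ((∑ i, nsq (x i)) + nsq y) ≤ 1000000 * ((∑ i, nsq (u i)) + ∑ a ∈ S, v a ^ 2) ∧
    (∑ i, nsq (u i)) + ∑ a ∈ S, v a ^ 2 ≤ 1000000 * (s ^ 2 * ((∑ i, nsq (x i)) + nsq y)) := by
  have hmR : (3 : ℝ) ≤ m := by exact_mod_cast hm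
  have hmR' : (m : ℝ) ≤ 11 := by exact_mod_cast hm'
  set σ : ι → ℝ := ∑ j, x j with hσ
  set X := ∑ i, nsq (x i) with hX
  set Y := nsq y with hY
  set U := ∑ i, nsq (u i) with hU
  set V := ∑ a ∈ S, v a ^ 2 with hV
  have hX0 : 0 ≤ X := Finset.sum_nonneg fun i _ => nsq_nonneg _
  have hY0 : 0 ≤ Y := nsq_nonneg _
  have hU0 : 0 ≤ U := Finset.sum_nonneg fun i _ => nsq_nonneg _
  have hV0 : 0 ≤ V := Finset.sum_nonneg fun i _ => sq_nonneg _
  have hq : 0 < s ^ 2 := by positivity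
  have hF := nsq_mulVec T.F _ T.FF
  have hG := nsq_mulVec T.G _ T.GG
  have hH := nsq_mulVec T.H _ T.HH
  have hFt := nsq_mulVec T.Fᵀ (s ^ 2) (by rw [Matrix.transpose_transpose]; exact T.FF')
  have hσX : nsq σ ≤ m * X := nsq_sum_le x
  have hσX' : nsq σ ≤ 11 * X := hσX.trans (by gcongr)
  have hSle : ∀ w : ι → ℝ, ∑ a ∈ S, w a ^ 2 ≤ nsq w := fun w =>
    Finset.sum_le_sum_of_subset_of_nonneg (Finset.subset_univ _) fun _ _ _ => sq_nonneg _
  have hSy : ∑ a ∈ S, y a ^ 2 = Y :=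
    Finset.sum_subset (Finset.subset_univ _) fun a _ ha => by rw [hy a ha]; simp
  have hconst : ∀ c : ℝ, ∑ _i : Fin m, c = m * c := by intro c; simp
  constructor
  · set τ : ι → ℝ := ∑ i, u i with hτ
    have hτU : nsq τ ≤ 11 * U := (nsq_sum_le u).trans (by gcongr)
    have hτe : τ = ((m : ℝ) - 2) • (T.H *ᵥ σ) + (m : ℝ) • (T.F *ᵥ y) := by
      have h1 : ∑ i, T.H *ᵥ x i = T.H *ᵥ σ := by
        rw [hσ]; exact (map_sum (Matrix.mulVecLin T.H) x Finset.univ).symm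
      rw [hτ, Finset.sum_congr rfl fun i _ => hu i, Finset.sum_add_distrib,
        Finset.sum_sub_distrib, ← Finset.smul_sum, h1]
      simp only [Finset.sum_const, Finset.card_univ, Fintype.card_fin]
      ext a
      simp
      ring
    have hFτ : T.Fᵀ *ᵥ τ = (((m : ℝ) - 2) * s) • (T.G *ᵥ σ) + ((m : ℝ) * s ^ 2) • y := by
      rw [hτe, Matrix.mulVec_add, Matrix.mulVec_smul, Matrix.mulVec_smul, Matrix.mulVec_mulVec,
        Matrix.mulVec_mulVec, T.FH, T.FF, Matrix.smul_mulVec, Matrix.smul_mulVec,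
        Matrix.one_mulVec, smul_smul, smul_smul]
    have key : ∀ a, s ^ 2 * (2 * m * (s ^ 2 * y a ^ 2) - 2 * (m - 2) * (T.H *ᵥ y) a ^ 2) ≤
        2 * (T.Fᵀ *ᵥ τ) a ^ 2 + 2 * (81 * s ^ 2) * v a ^ 2 := by
      intro a
      have e1 : (T.Fᵀ *ᵥ τ) a - ((m : ℝ) - 2) * s * v a
          = s * (m * (s * y a) - (m - 2) * (T.H *ᵥ y) a) := by
        rw [hFτ, hv]; simp; ring
      set p := (T.Fᵀ *ᵥ τ) a
      set b := (T.H *ᵥ y) a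
      set d := v a
      have e2 : s ^ 2 * (2 * m * (s ^ 2 * y a ^ 2) - 2 * (m - 2) * b ^ 2) ≤
          (p - ((m : ℝ) - 2) * s * d) ^ 2 := by
        rw [e1, mul_pow]
        gcongr
        nlinarith [mul_nonneg (mul_nonneg (by linarith : (0:ℝ) ≤ m) (by linarith : (0:ℝ) ≤ m - 2))
          (sq_nonneg (s * y a - b))]
      have e3 : (p - ((m : ℝ) - 2) * s * d) ^ 2 ≤ 2 * p ^ 2 + 2 * (((m : ℝ) - 2) * s * d) ^ 2 := by
        nlinarith [sq_nonneg (p + ((m : ℝ) - 2) * s * d)]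
      have e4 : (((m : ℝ) - 2) * s * d) ^ 2 ≤ 81 * s ^ 2 * d ^ 2 := by
        rw [mul_pow, mul_pow]
        gcongr
        nlinarith
      linarith
    have keyS := Finset.sum_le_sum fun a (_ : a ∈ S) => key a
    rw [← Finset.mul_sum, Finset.sum_sub_distrib, ← Finset.mul_sum, ← Finset.mul_sum,
      ← Finset.mul_sum, Finset.sum_add_distrib, ← Finset.mul_sum, ← Finset.mul_sum, hSy] at keyS
    have hb : ∑ a ∈ S, (T.H *ᵥ y) a ^ 2 ≤ s ^ 2 * Y := (hSle _).trans (hH y).le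
    have hp : ∑ a ∈ S, (T.Fᵀ *ᵥ τ) a ^ 2 ≤ s ^ 2 * (11 * U) :=
      (hSle _).trans ((hFt τ).le.trans (by gcongr))
    have hY1 : s ^ 2 * (4 * (s ^ 2 * Y)) ≤ s ^ 2 * (22 * U + 162 * V) := by
      have : s ^ 2 * (4 * (s ^ 2 * Y)) ≤ s ^ 2 * (2 * m * (s ^ 2 * Y) -
          2 * (m - 2) * ∑ a ∈ S, (T.H *ᵥ y) a ^ 2) := by
        gcongr
        nlinarith
      linarith
    have hY2 := le_of_mul_le_mul_left hY1 hq
    have hσ1 : nsq (T.H *ᵥ σ) ≤ 2 * (11 * U + 121 * (s ^ 2 * Y)) := by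
      have h1 := nsq_two τ (-((m : ℝ) • (T.F *ᵥ y))) (((m : ℝ) - 2) • (T.H *ᵥ σ)) (by
        intro a; rw [hτe]; simp)
      rw [← neg_smul, nsq_smul, nsq_smul, hF] at h1
      have h2 : nsq (T.H *ᵥ σ) ≤ ((m : ℝ) - 2) ^ 2 * nsq (T.H *ᵥ σ) := by
        have := nsq_nonneg (T.H *ᵥ σ)
        have h3 : (1 : ℝ) ≤ (m - 2) ^ 2 := by nlinarith
        nlinarith
      have h4 : (-(m : ℝ)) ^ 2 * (s ^ 2 * Y) ≤ 121 * (s ^ 2 * Y) := by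
        gcongr
        nlinarith
      linarith
    have hx1 : ∀ i, 4 * (s ^ 2 * nsq (x i)) ≤
        3 * (nsq (T.H *ᵥ σ) + s ^ 2 * Y + nsq (u i)) := by
      intro i
      have h1 := nsq_three (T.H *ᵥ σ) (T.F *ᵥ y) (-(u i)) ((2 : ℝ) • (T.H *ᵥ x i)) (by
        intro a; rw [hu i]; simp)
      have h2 : nsq (-(u i)) = nsq (u i) := by simp [nsq]
      rw [nsq_smul, h2, hF, hH (x i)] at h1
      linarith
    have hx2 := Finset.sum_le_sum fun i (_ : i ∈ (Finset.univ : Finset (Fin m))) => hx1 i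
    rw [← Finset.mul_sum, ← Finset.mul_sum, ← Finset.mul_sum, Finset.sum_add_distrib, hconst] at hx2
    have h5 : (m : ℝ) * (nsq (T.H *ᵥ σ) + s ^ 2 * Y) ≤ 11 * (nsq (T.H *ᵥ σ) + s ^ 2 * Y) := by
      have := nsq_nonneg (T.H *ᵥ σ)
      gcongr
    change 4 * (s ^ 2 * X) ≤ 3 * (_ + U) at hx2
    nlinarith
  · have hu1 : ∀ i, nsq (u i) ≤ 3 * (s ^ 2 * nsq σ + s ^ 2 * Y + 4 * (s ^ 2 * nsq (x i))) := by
      intro i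
      have h1 := nsq_three (T.H *ᵥ σ) (T.F *ᵥ y) ((-2 : ℝ) • (T.H *ᵥ x i)) (u i) (by
        intro a; rw [hu i]; simp; ring)
      rw [nsq_smul, hH, hF, hH] at h1
      linarith
    have hu2 := Finset.sum_le_sum fun i (_ : i ∈ (Finset.univ : Finset (Fin m))) => hu1 i
    rw [← Finset.mul_sum, Finset.sum_add_distrib, ← Finset.mul_sum, ← Finset.mul_sum, hconst] at hu2
    change U ≤ 3 * (_ + 4 * (s ^ 2 * X)) at hu2
    have hv1 : V ≤ 2 * (s ^ 2 * nsq σ + s ^ 2 * Y) := by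
      have h1 := nsq_two (T.G *ᵥ σ) (T.H *ᵥ y) v (by intro a; rw [hv]; simp)
      rw [hG, hH] at h1
      exact (hSle v).trans h1
    have h3 : s ^ 2 * nsq σ ≤ s ^ 2 * (11 * X) := by gcongr
    have h4 : (m : ℝ) * (s ^ 2 * nsq σ + s ^ 2 * Y) ≤ 11 * (s ^ 2 * (11 * X) + s ^ 2 * Y) := by
      have h0 : 0 ≤ s ^ 2 * nsq σ + s ^ 2 * Y :=
        add_nonneg (mul_nonneg hq.le (nsq_nonneg _)) (mul_nonneg hq.le hY0)
      exact mul_le_mul hmR' (add_le_add_left h3 _) h0 (by norm_num)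
    have h5 : 0 ≤ s ^ 2 * X := mul_nonneg hq.le hX0
    have h6 : 0 ≤ s ^ 2 * Y := mul_nonneg hq.le hY0
    linarith

/-- the block matrix -/
def bigMat {ι : Type} [Fintype ι] [DecidableEq ι] {s : ℝ} (T : Triple ι s)
    (m : ℕ) (S : Finset ι) : Matrix ((Fin m × ι) ⊕ S) ((Fin m × ι) ⊕ S) ℝ :=
  Matrix.of fun p p' => match p, p' with
    | Sum.inl (i, a), Sum.inl (j, b) => (if i = j then -1 else 1) * T.H a b
    | Sum.inl (_, a), Sum.inr t => T.F a t
    | Sum.inr t, Sum.inl (_, b) => T.G t b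
    | Sum.inr t, Sum.inr t' => T.H t t'

lemma bigMat_pm {ι : Type} [Fintype ι] [DecidableEq ι] {s : ℝ} (T : Triple ι s)
    (m : ℕ) (S : Finset ι) (p p') : bigMat T m S p p' = 1 ∨ bigMat T m S p p' = -1 := by
  rcases p with ⟨i, a⟩ | t <;> rcases p' with ⟨j, b⟩ | t'
  · refine pm_mul ?_ (T.hH a b)
    split_ifs <;> simp
  · exact T.hF _ _
  · exact T.hG _ _
  · exact T.hH _ _

lemma bigMat_bounds {ι : Type} [Fintype ι] [DecidableEq ι] {s : ℝ} (hs : 0 < s) (T : Triple ι s)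
    (m : ℕ) (hm : 3 ≤ m) (hm' : m ≤ 11) (S : Finset ι) (z : (Fin m × ι) ⊕ S → ℝ) :
    s ^ 2 * nsq z ≤ 1000000 * nsq (bigMat T m S *ᵥ z) ∧
    nsq (bigMat T m S *ᵥ z) ≤ 1000000 * (s ^ 2 * nsq z) := by
  set x : Fin m → ι → ℝ := fun i a => z (Sum.inl (i, a)) with hx
  set y : ι → ℝ := fun a => if h : a ∈ S then z (Sum.inr ⟨a, h⟩) else 0 with hy
  have hyS : ∀ t : S, y t = z (Sum.inr t) := by intro t; simp [hy]
  have hy0 : ∀ a, a ∉ S → y a = 0 := by intro a ha; simp [hy, ha]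
  have hsum : ∀ f : ι → ℝ, ∑ t : S, f t * z (Sum.inr t) = ∑ a, f a * y a := by
    intro f
    rw [← Finset.sum_subset (Finset.subset_univ S) (fun a _ ha => by rw [hy0 a ha, mul_zero]),
      ← Finset.sum_coe_sort S]
    exact Finset.sum_congr rfl fun t _ => by rw [hyS]
  have hnz : nsq z = (∑ i, nsq (x i)) + nsq y := by
    unfold nsq
    rw [Fintype.sum_sum_type, Fintype.sum_prod_type]
    congr 1
    rw [← Finset.sum_subset (Finset.subset_univ S) (fun a _ ha => by rw [hy0 a ha]; simp),
      ← Finset.sum_coe_sort S]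
    exact Finset.sum_congr rfl fun t _ => by rw [hyS]
  obtain ⟨h1, h2⟩ := core_bounds hs T m hm hm' S x y hy0
    (fun i => T.H *ᵥ (∑ j, x j) - (2 : ℝ) • (T.H *ᵥ x i) + T.F *ᵥ y)
    (T.G *ᵥ (∑ j, x j) + T.H *ᵥ y) (fun i => rfl) rfl
  have hlin : ∀ M : Matrix ι ι ℝ, ∀ a, (M *ᵥ (∑ j, x j)) a = ∑ j, ∑ b, M a b * x j b := by
    intro M a
    simp only [Matrix.mulVec, dotProduct, Finset.sum_apply, Finset.mul_sum]
    exact Finset.sum_comm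
  have hnu : nsq (bigMat T m S *ᵥ z) =
      (∑ i, nsq (T.H *ᵥ (∑ j, x j) - (2 : ℝ) • (T.H *ᵥ x i) + T.F *ᵥ y)) +
      ∑ a ∈ S, (T.G *ᵥ (∑ j, x j) + T.H *ᵥ y) a ^ 2 := by
    unfold nsq
    rw [Fintype.sum_sum_type, Fintype.sum_prod_type]
    congr 1
    · refine Finset.sum_congr rfl fun i _ => Finset.sum_congr rfl fun a _ => ?_
      congr 1
      simp only [Pi.add_apply, Pi.sub_apply, Pi.smul_apply, hlin, smul_eq_mul]
      simp only [Matrix.mulVec, dotProduct]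
      rw [Fintype.sum_sum_type, Fintype.sum_prod_type]
      congr 1
      · have : ∀ j : Fin m, ∑ b, bigMat T m S (Sum.inl (i, a)) (Sum.inl (j, b)) * z (Sum.inl (j, b))
            = ∑ b, T.H a b * x j b - (if i = j then 2 * ∑ b, T.H a b * x j b else 0) := by
          intro j
          simp only [bigMat, Matrix.of_apply, mul_assoc]
          rw [← Finset.mul_sum]
          split_ifs <;> simp only [hx] <;> ring
        rw [Finset.sum_congr rfl fun j _ => this j, Finset.sum_sub_distrib]
        simp
      · exact hsum fun b => T.F a b
    · rw [← Finset.sum_coe_sort S]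
      refine Finset.sum_congr rfl fun t _ => ?_
      congr 1
      simp only [Pi.add_apply, hlin]
      simp only [Matrix.mulVec, dotProduct]
      rw [Fintype.sum_sum_type, Fintype.sum_prod_type]
      congr 1
      exact hsum fun b => T.H t b
  rw [hnu, hnz]
  exact ⟨h1, h2⟩

lemma exists_fin_ge (n : ℕ) (hn : 3 ≤ n) : ∃ A : Matrix (Fin n) (Fin n) ℝ,
    (∀ i j, A i j = 1 ∨ A i j = -1) ∧ ∀ z, n * nsq z ≤ 12000000 * nsq (A *ᵥ z) ∧
      nsq (A *ᵥ z) ≤ 12000000 * (n * nsq z) := by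
  set k := Nat.log 4 (n / 3) with hk
  have h1 : 4 ^ k ≤ n / 3 := Nat.pow_log_le_self 4 (by omega)
  have h2 : n / 3 < 4 ^ (k + 1) := Nat.lt_pow_succ_log_self (by norm_num) _
  rw [pow_succ] at h2
  obtain ⟨ι, _, _, hc, ⟨T⟩⟩ := exists_triple k
  set q := 4 ^ k with hq
  have hq0 : 0 < q := by positivity
  set m := n / q with hm
  have hdm : q * m + n % q = n := Nat.div_add_mod n q
  have hr : n % q < q := Nat.mod_lt _ hq0
  have hm3 : 3 ≤ m := by rw [hm, Nat.le_div_iff_mul_le hq0]; omega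
  have hm11 : m ≤ 11 := by
    have : m < 12 := by rw [hm, Nat.div_lt_iff_lt_mul hq0]; omega
    omega
  obtain ⟨S, hS⟩ := Finset.exists_subset_card_eq (s := (Finset.univ : Finset ι)) (n := n % q)
    (by rw [Finset.card_univ, hc]; exact hr.le)
  have hcard : Fintype.card ((Fin m × ι) ⊕ S) = n := by
    simp only [Fintype.card_sum, Fintype.card_prod, Fintype.card_fin, hc, Fintype.card_coe, hS.2]
    rw [mul_comm]; exact hdm
  let e : ((Fin m × ι) ⊕ S) ≃ Fin n := Fintype.equivFinOfCardEq hcard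
  refine ⟨(bigMat T m S).submatrix e.symm e.symm, fun i j => bigMat_pm _ _ _ _ _, fun z => ?_⟩
  have hn1 : nsq z = nsq (z ∘ e) := (Equiv.sum_comp e fun i => z i ^ 2).symm
  have hn2 : nsq ((bigMat T m S).submatrix e.symm e.symm *ᵥ z) =
      nsq (bigMat T m S *ᵥ (z ∘ e)) := by
    rw [Matrix.submatrix_mulVec_equiv]
    exact Equiv.sum_comp e.symm fun i => (bigMat T m S *ᵥ (z ∘ e)) i ^ 2
  obtain ⟨b1, b2⟩ := bigMat_bounds (by positivity) T m hm3 hm11 S (z ∘ e)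
  have hs : ((2 : ℝ) ^ k) ^ 2 = q := by rw [hq]; push_cast; rw [← pow_mul, mul_comm, pow_mul]; norm_num
  rw [hs] at b1 b2
  rw [hn1, hn2]
  have hz := nsq_nonneg (z ∘ e)
  have hle : (q : ℝ) ≤ n := by exact_mod_cast (by omega : q ≤ n)
  have hge : (n : ℝ) ≤ 12 * q := by exact_mod_cast (by omega : n ≤ 12 * q)
  constructor
  · nlinarith [mul_le_mul_of_nonneg_right hge hz]
  · nlinarith [mul_le_mul_of_nonneg_right hle hz, mul_nonneg (Nat.cast_nonneg (α := ℝ) n) hz]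

lemma exists_fin (n : ℕ) : ∃ A : Matrix (Fin n) (Fin n) ℝ,
    (∀ i j, A i j = 1 ∨ A i j = -1) ∧ ∀ z, n * nsq z ≤ 12000000 * nsq (A *ᵥ z) ∧
      nsq (A *ᵥ z) ≤ 12000000 * (n * nsq z) := by
  rcases Nat.lt_or_ge n 3 with h | h
  · interval_cases n
    · exact ⟨1, fun i => i.elim0, fun z => by simp [nsq]⟩
    · refine ⟨!![1], by intro i j; fin_cases i; fin_cases j; simp, fun z => ?_⟩
      simp only [nsq, Matrix.mulVec, dotProduct, Fin.sum_univ_one]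
      simp
      nlinarith [sq_nonneg (z 0)]
    · refine ⟨!![1, -1; 1, 1], by intro i j; fin_cases i <;> fin_cases j <;> simp, fun z => ?_⟩
      simp only [nsq, Matrix.mulVec, dotProduct, Fin.sum_univ_two]
      simp
      constructor <;> nlinarith [sq_nonneg (z 0), sq_nonneg (z 1)]
  · exact exists_fin_ge n h

lemma nsq_eq_norm {n : ℕ} (A : Matrix (Fin n) (Fin n) ℝ) (x : EuclideanSpace ℝ (Fin n)) :
    nsq (A *ᵥ x.ofLp) = ‖Matrix.toEuclideanLin A x‖ ^ 2 := by
  rw [EuclideanSpace.norm_sq_eq]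
  simp [nsq, Matrix.toLpLin_apply]

lemma nsq_eq_norm' {n : ℕ} (x : EuclideanSpace ℝ (Fin n)) : nsq x.ofLp = ‖x‖ ^ 2 := by
  rw [EuclideanSpace.norm_sq_eq]
  simp [nsq]

lemma sMax_transpose {n : ℕ} (A : Matrix (Fin n) (Fin n) ℝ) : sMax Aᵀ = sMax A := by
  have h : Aᵀ = Aᴴ := by simp
  rw [h]
  open scoped Matrix.Norms.L2Operator in
  exact Matrix.l2_opNorm_conjTranspose A

theorem approximately_hadamard_exists :
    ∃ c C : ℝ, 0 < c ∧ c < C ∧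
      ∀ n : ℕ, ∃ V : Matrix (Fin n) (Fin n) ℝ,
        (∀ i j, V i j = 1 ∨ V i j = -1) ∧
        c * Real.sqrt n ≤ sMin V ∧ sMin V ≤ sMax V ∧ sMax V ≤ C * Real.sqrt n := by
  refine ⟨1 / 4000, 4000, by norm_num, by norm_num, fun n => ?_⟩
  obtain ⟨A, hA, hb⟩ := exists_fin n
  refine ⟨Aᵀ, fun i j => hA j i, ?_⟩
  have hsn : (0 : ℝ) ≤ Real.sqrt n := Real.sqrt_nonneg _
  have hsq : Real.sqrt n ^ 2 = n := Real.sq_sqrt (Nat.cast_nonneg n)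
  have hup : sMax A ≤ 4000 * Real.sqrt n := by
    refine ContinuousLinearMap.opNorm_le_bound _ (by positivity) fun x => ?_
    have h := (hb x.ofLp).2
    rw [nsq_eq_norm, nsq_eq_norm'] at h
    refine le_of_sq_le_sq ?_ (by positivity)
    change ‖Matrix.toEuclideanLin A x‖ ^ 2 ≤ _
    rw [mul_pow, mul_pow, hsq]
    nlinarith [mul_nonneg (Nat.cast_nonneg (α := ℝ) n) (sq_nonneg ‖x‖)]
  have hlow : ∀ x : EuclideanSpace ℝ (Fin n), ‖x‖ = 1 →
      1 / 4000 * Real.sqrt n ≤ ‖Matrix.toEuclideanLin A x‖ := by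
    intro x hx
    have h := (hb x.ofLp).1
    rw [nsq_eq_norm, nsq_eq_norm', hx] at h
    refine le_of_sq_le_sq ?_ (norm_nonneg _)
    rw [mul_pow, hsq]
    linarith [Nat.cast_nonneg (α := ℝ) n]
  rw [sMax_transpose]
  rcases Nat.eq_zero_or_pos n with rfl | hn
  · have h0 : sMin Aᵀ = 0 := by
      unfold sMin
      have : IsEmpty {x : EuclideanSpace ℝ (Fin 0) // ‖x‖ = 1} :=
        ⟨fun x => by have := x.2; rw [Subsingleton.elim x.1 0] at this; simp at this⟩
      exact Real.iInf_of_isEmpty _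
    rw [h0]
    refine ⟨by simp, norm_nonneg _, hup⟩
  · have x0 : {x : EuclideanSpace ℝ (Fin n) // ‖x‖ = 1} :=
      ⟨EuclideanSpace.single ⟨0, hn⟩ 1, by simp⟩
    have : Nonempty {x : EuclideanSpace ℝ (Fin n) // ‖x‖ = 1} := ⟨x0⟩
    refine ⟨?_, ?_, hup⟩
    · unfold sMin
      rw [Matrix.transpose_transpose]
      exact le_ciInf fun x => hlow x.1 x.2
    · unfold sMin
      rw [Matrix.transpose_transpose]
      refine (ciInf_le ⟨0, ?_⟩ x0).trans ?_
      · rintro _ ⟨x, rfl⟩; exact norm_nonneg _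
      · have := (LinearMap.toContinuousLinearMap (Matrix.toEuclideanLin A)).le_opNorm x0.1
        rw [x0.2, mul_one] at this
        exact this
end

section
/- There exists an absolute constant C > 0 such that for every odd prime q there is a q × q matrix U_q with entries ±1 satisfying √q·(1 − δ_q) ≤ s_min(U_q) ≤ s_max(U_q) ≤ √q·(1 + δ_q), where δ_q = C·q^{−1/4}·√(log q). -/
open Matrix

open Finset

theorem exists_subset_dev {α J : Type*} [DecidableEq α] [Fintype J] (N : Finset α)
    (c : J → α → ℝ) (hc : ∀ j x, |c j x| ≤ 1) (p l t : ℝ) (hp0 : 0 ≤ p) (hp1 : p ≤ 1)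
    (hl0 : 0 < l) (hl1 : l ≤ 1)
    (hJ : 2 * (Fintype.card J : ℝ) * Real.exp (p * N.card * l ^ 2) < Real.exp (l * t)) :
    ∃ T ⊆ N, ∀ j, |∑ x ∈ T, c j x - p * ∑ x ∈ N, c j x| ≤ t := by
  -- moment bound for a generic coefficient function and sign
  have mom : ∀ d : α → ℝ, (∀ x, |d x| ≤ 1) →
      ∑ T ∈ N.powerset, (p ^ T.card * (1 - p) ^ (N \ T).card) *
        Real.exp (l * (∑ x ∈ T, d x - p * ∑ x ∈ N, d x)) ≤ Real.exp (p * N.card * l ^ 2) := by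
    intro d hd
    have h1 : ∀ T ∈ N.powerset, (p ^ T.card * (1 - p) ^ (N \ T).card) *
        Real.exp (l * (∑ x ∈ T, d x - p * ∑ x ∈ N, d x))
        = ((∏ x ∈ T, p * Real.exp (l * d x)) * ∏ x ∈ N \ T, (1 - p)) *
          Real.exp (-(l * (p * ∑ x ∈ N, d x))) := by
      intro T _
      rw [prod_mul_distrib, prod_const, prod_const, ← Real.exp_sum, ← mul_sum, mul_sub,
        sub_eq_add_neg (l * _), Real.exp_add]
      ring
    rw [sum_congr rfl h1, ← sum_mul, ← prod_add]
    have h2 : ∏ x ∈ N, (p * Real.exp (l * d x) + (1 - p)) ≤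
        ∏ x ∈ N, Real.exp (p * (l * d x) + p * l ^ 2) := by
      apply prod_le_prod
      · intro x _
        have := Real.exp_pos (l * d x)
        have : 0 ≤ 1 - p := by linarith
        positivity
      · intro x _
        have hy : |l * d x| ≤ 1 := by
          rw [abs_mul, abs_of_pos hl0]
          nlinarith [hd x, abs_nonneg (d x)]
        have h3 := (abs_le.1 (Real.abs_exp_sub_one_sub_id_le hy)).2
        have h4 : (l * d x) ^ 2 ≤ l ^ 2 := by
          rw [mul_pow]
          have : d x ^ 2 ≤ 1 := by rw [sq_le_one_iff_abs_le_one]; exact hd x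
          nlinarith [sq_nonneg l]
        have h5 : p * (Real.exp (l * d x) - 1 - l * d x) ≤ p * l ^ 2 :=
          mul_le_mul_of_nonneg_left (h3.trans h4) hp0
        have h6 := Real.add_one_le_exp (p * (l * d x) + p * l ^ 2)
        linarith
    calc _ ≤ (∏ x ∈ N, Real.exp (p * (l * d x) + p * l ^ 2)) *
          Real.exp (-(l * (p * ∑ x ∈ N, d x))) :=
          mul_le_mul_of_nonneg_right h2 (Real.exp_pos _).le
      _ = _ := by
          rw [← Real.exp_sum, ← Real.exp_add, sum_add_distrib, ← mul_sum, ← mul_sum, sum_const,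
            nsmul_eq_mul]
          congr 1; ring
  have tot : ∑ T ∈ N.powerset, (p ^ T.card * (1 - p) ^ (N \ T).card) = 1 := by
    have := prod_add (fun _ : α => p) (fun _ => 1 - p) N
    simp only [prod_const] at this
    rw [← this]; simp
  by_contra! hcon
  have key : ∀ T ∈ N.powerset, Real.exp (l * t) ≤
      ∑ j, (Real.exp (l * (∑ x ∈ T, c j x - p * ∑ x ∈ N, c j x)) +
        Real.exp (l * (∑ x ∈ T, -c j x - p * ∑ x ∈ N, -c j x))) := by
    intro T hT
    obtain ⟨j, hj⟩ := hcon T (mem_powerset.1 hT)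
    refine le_trans ?_ (single_le_sum (f := fun j =>
      (Real.exp (l * (∑ x ∈ T, c j x - p * ∑ x ∈ N, c j x)) +
        Real.exp (l * (∑ x ∈ T, -c j x - p * ∑ x ∈ N, -c j x)))) (fun i _ => by positivity)
        (mem_univ j))
    simp only [sum_neg_distrib]
    rcases lt_abs.1 hj with h | h
    · have : Real.exp (l * t) ≤ Real.exp (l * (∑ x ∈ T, c j x - p * ∑ x ∈ N, c j x)) :=
        Real.exp_le_exp.2 (mul_le_mul_of_nonneg_left h.le hl0.le)
      have := Real.exp_pos (l * (-∑ x ∈ T, c j x - p * -∑ x ∈ N, c j x))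
      linarith
    · have : Real.exp (l * t) ≤ Real.exp (l * (-∑ x ∈ T, c j x - p * -∑ x ∈ N, c j x)) :=
        Real.exp_le_exp.2 (mul_le_mul_of_nonneg_left (by linarith) hl0.le)
      have := Real.exp_pos (l * (∑ x ∈ T, c j x - p * ∑ x ∈ N, c j x))
      linarith
  have : Real.exp (l * t) ≤ 2 * (Fintype.card J : ℝ) * Real.exp (p * N.card * l ^ 2) := by
    calc Real.exp (l * t) = ∑ T ∈ N.powerset,
          (p ^ T.card * (1 - p) ^ (N \ T).card) * Real.exp (l * t) := by
          rw [← sum_mul, tot, one_mul]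
      _ ≤ ∑ T ∈ N.powerset, (p ^ T.card * (1 - p) ^ (N \ T).card) *
          ∑ j, (Real.exp (l * (∑ x ∈ T, c j x - p * ∑ x ∈ N, c j x)) +
        Real.exp (l * (∑ x ∈ T, -c j x - p * ∑ x ∈ N, -c j x))) := by
          apply sum_le_sum
          intro T hT
          have : 0 ≤ 1 - p := by linarith
          exact mul_le_mul_of_nonneg_left (key T hT) (by positivity)
      _ = ∑ j, (∑ T ∈ N.powerset, (p ^ T.card * (1 - p) ^ (N \ T).card) *
            Real.exp (l * (∑ x ∈ T, c j x - p * ∑ x ∈ N, c j x)) +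
          ∑ T ∈ N.powerset, (p ^ T.card * (1 - p) ^ (N \ T).card) *
            Real.exp (l * (∑ x ∈ T, -c j x - p * ∑ x ∈ N, -c j x))) := by
          simp only [mul_sum, ← sum_add_distrib, ← mul_add]
          rw [sum_comm]
          
      _ ≤ ∑ j : J, (Real.exp (p * N.card * l ^ 2) + Real.exp (p * N.card * l ^ 2)) := by
          apply sum_le_sum
          intro j _
          exact add_le_add (mom (c j) (hc j)) (mom (fun x => -c j x) (fun x => by
            rw [abs_neg]; exact hc j x))
      _ = _ := by
          rw [sum_const, card_univ, nsmul_eq_mul]; ring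
  linarith

section
variable {q : ℕ} [Fact q.Prime]

/-- Fourier transform on `ZMod q`. -/
noncomputable def fou (g : ZMod q → ℂ) (k : ZMod q) : ℂ :=
  ∑ x, g x * ZMod.stdAddChar (k * x)

theorem parseval (g : ZMod q → ℂ) : ∑ k, ‖fou g k‖ ^ 2 = q * ∑ x, ‖g x‖ ^ 2 := by
  have : (∑ k, (‖fou g k‖ : ℂ) ^ 2) = q * ∑ x, (‖g x‖ : ℂ) ^ 2 := by
    simp only [← Complex.mul_conj', fou, map_sum, map_mul, ← AddChar.map_neg_eq_conj, sum_mul_sum]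
    rw [sum_comm, mul_sum]
    refine sum_congr rfl fun x _ => ?_
    rw [sum_comm]
    have : ∀ y, ∑ k : ZMod q, g x * ZMod.stdAddChar (k * x) *
        ((starRingEnd ℂ) (g y) * ZMod.stdAddChar (-(k * y)))
        = if x = y then q * (g x * (starRingEnd ℂ) (g y)) else 0 := by
      intro y
      have h := AddChar.sum_mulShift (x - y) (ZMod.isPrimitive_stdAddChar q)
      rw [ZMod.card] at h
      calc _ = ∑ k : ZMod q, g x * (starRingEnd ℂ) (g y) * ZMod.stdAddChar (k * (x - y)) := by
            refine sum_congr rfl fun k _ => ?_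
            rw [mul_sub, sub_eq_add_neg, AddChar.map_add_eq_mul]; ring
        _ = _ := by
            rw [← mul_sum, h]
            simp only [sub_eq_zero]
            split_ifs <;> push_cast <;> ring
    simp [this]
  exact_mod_cast this

theorem fou_conv (f g : ZMod q → ℂ) (k : ZMod q) :
    fou (fun i => ∑ j, f (i - j) * g j) k = fou f k * fou g k := by
  simp only [fou, sum_mul_sum]
  simp only [sum_mul]
  rw [sum_comm]
  conv_rhs => rw [sum_comm]
  refine sum_congr rfl fun j _ => ?_
  rw [← Equiv.sum_comp (Equiv.addRight j)]
  refine sum_congr rfl fun i _ => ?_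
  simp only [Equiv.coe_addRight, add_sub_cancel_right, mul_add, AddChar.map_add_eq_mul]
  ring

theorem conv_bounds (f g : ZMod q → ℂ) (m M : ℝ) (hm : 0 ≤ m) (h1 : ∀ k, m ≤ ‖fou f k‖)
    (h2 : ∀ k, ‖fou f k‖ ≤ M) :
    m ^ 2 * ∑ x, ‖g x‖ ^ 2 ≤ ∑ i, ‖∑ j, f (i - j) * g j‖ ^ 2 ∧
    ∑ i, ‖∑ j, f (i - j) * g j‖ ^ 2 ≤ M ^ 2 * ∑ x, ‖g x‖ ^ 2 := by
  have hq : (0 : ℝ) < q := by exact_mod_cast (Fact.out : q.Prime).pos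
  have e1 := parseval (fun i => ∑ j, f (i - j) * g j)
  have e2 := parseval g
  simp only [fou_conv, norm_mul, mul_pow] at e1
  constructor
  · refine le_of_mul_le_mul_left ?_ hq
    rw [← e1, mul_left_comm, ← e2, mul_sum]
    refine sum_le_sum fun k _ => ?_
    gcongr
    exact h1 k
  · refine le_of_mul_le_mul_left ?_ hq
    rw [← e1, mul_left_comm, ← e2, mul_sum]
    refine sum_le_sum fun k _ => ?_
    gcongr
    exact h2 k

theorem lin_bounds (e : Fin q ≃ ZMod q) (f : ZMod q → ℝ) (m M : ℝ) (hm : 0 ≤ m)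
    (h1 : ∀ k, m ≤ ‖fou (fun x => (f x : ℂ)) k‖)
    (h2 : ∀ k, ‖fou (fun x => (f x : ℂ)) k‖ ≤ M) (v : EuclideanSpace ℝ (Fin q)) :
    m * ‖v‖ ≤ ‖Matrix.toEuclideanLin (Matrix.of fun i j => f (e i - e j)) v‖ ∧
    ‖Matrix.toEuclideanLin (Matrix.of fun i j => f (e i - e j)) v‖ ≤ M * ‖v‖ := by
  have hM : 0 ≤ M := (norm_nonneg _).trans (h2 0)
  have key := conv_bounds (fun x => (f x : ℂ)) (fun x => (v (e.symm x) : ℂ)) m M hm h1 h2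
  have ev : ∑ x, ‖(v (e.symm x) : ℂ)‖ ^ 2 = ‖v‖ ^ 2 := by
    rw [EuclideanSpace.norm_sq_eq, ← e.sum_comp]
    simp
  have eU : ∑ i, ‖∑ j, (f (i - j) : ℂ) * (v (e.symm j) : ℂ)‖ ^ 2 =
      ‖Matrix.toEuclideanLin (Matrix.of fun i j => f (e i - e j)) v‖ ^ 2 := by
    rw [EuclideanSpace.norm_sq_eq, ← e.sum_comp]
    refine sum_congr rfl fun i _ => ?_
    rw [← e.sum_comp]
    simp only [Equiv.symm_apply_apply, Matrix.toLpLin_apply, Matrix.mulVec, dotProduct,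
      Matrix.of_apply, ← Complex.ofReal_mul, ← Complex.ofReal_sum, Complex.norm_real]
  rw [ev, eU, ← mul_pow, ← mul_pow] at key
  exact ⟨le_of_sq_le_sq key.1 (norm_nonneg _), le_of_sq_le_sq key.2 (by positivity)⟩

theorem matrix_bounds (f : ZMod q → ℝ) (m M : ℝ)
    (h1 : ∀ k, m ≤ ‖fou (fun x => (f x : ℂ)) k‖)
    (h2 : ∀ k, ‖fou (fun x => (f x : ℂ)) k‖ ≤ M) :
    ∃ U : Matrix (Fin q) (Fin q) ℝ, (∀ i j, ∃ x, U i j = f x) ∧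
      m ≤ sMin U ∧ sMin U ≤ sMax U ∧ sMax U ≤ M := by
  have hq : 0 < q := (Fact.out : q.Prime).pos
  have : Nonempty (Fin q) := ⟨⟨0, hq⟩⟩
  have hM : 0 ≤ M := (norm_nonneg _).trans (h2 0)
  let e : Fin q ≃ ZMod q := (Fintype.equivFinOfCardEq (ZMod.card q)).symm
  refine ⟨Matrix.of fun i j => f (e i - e j), fun i j => ⟨_, rfl⟩, ?_, ?_, ?_⟩
  · have hneg : ∀ k, fou (fun x => ((fun y => f (-y)) x : ℂ)) k =
        fou (fun x => (f x : ℂ)) (-k) := by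
      intro k
      simp only [fou]
      rw [← Equiv.sum_comp (Equiv.neg (ZMod q))]
      simp
    have hT : (Matrix.of fun i j => f (e i - e j))ᵀ =
        Matrix.of fun i j => (fun y => f (-y)) (e i - e j) := by
      ext i j; simp
    unfold sMin
    have : Nonempty {x : EuclideanSpace ℝ (Fin q) // ‖x‖ = 1} :=
      ⟨⟨EuclideanSpace.single ⟨0, hq⟩ 1, by simp⟩⟩
    refine le_ciInf fun x => ?_
    rcases le_total 0 m with hm | hm
    · have := (lin_bounds e (fun y => f (-y)) m M hm (fun k => by rw [hneg]; exact h1 _)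
        (fun k => by rw [hneg]; exact h2 _) x).1
      rw [x.2, mul_one] at this
      rw [hT]; exact this
    · exact hm.trans (norm_nonneg _)
  · generalize (Matrix.of fun i j => f (e i - e j)) = U
    let x : {x : EuclideanSpace ℝ (Fin q) // ‖x‖ = 1} :=
      ⟨EuclideanSpace.single ⟨0, hq⟩ 1, by simp⟩
    have a1 : sMin U ≤ ‖Matrix.toEuclideanLin Uᵀ x.1‖ :=
      ciInf_le (f := fun x : {x : EuclideanSpace ℝ (Fin q) // ‖x‖ = 1} =>
        ‖Matrix.toEuclideanLin Uᵀ x.1‖) ⟨0, by rintro _ ⟨y, rfl⟩; exact norm_nonneg _⟩ x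
    have a2 : ‖Matrix.toEuclideanLin Uᵀ x.1‖ ≤ sMax Uᵀ := by
      have := (LinearMap.toContinuousLinearMap (Matrix.toEuclideanLin Uᵀ)).le_opNorm x.1
      rw [x.2, mul_one] at this
      exact this
    have a3 : sMax Uᵀ = sMax U := by
      have := Matrix.l2_opNorm_conjTranspose U
      rw [Matrix.conjTranspose_eq_transpose_of_trivial] at this
      exact this
    linarith
  · exact ContinuousLinearMap.opNorm_le_bound _ hM fun v =>
      (lin_bounds e f 0 M le_rfl (fun k => norm_nonneg _) h2 v).2

theorem fou_quad (hq2 : q ≠ 2) (k : ZMod q) (hk : k ≠ 0) :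
    ‖fou (fun x => ((quadraticChar (ZMod q) x : ℤ) : ℂ)) k‖ = Real.sqrt q := by
  have hr : ringChar (ZMod q) ≠ 2 := by rwa [ZMod.ringChar_zmod_n]
  set χ : MulChar (ZMod q) ℂ := (quadraticChar (ZMod q)).ringHomComp (Int.castRingHom ℂ) with hχ
  have hq : χ.IsQuadratic := (quadraticChar_isQuadratic (ZMod q)).comp _
  have h1 : χ ≠ 1 := by
    intro h
    apply quadraticChar_ne_one hr
    ext x
    have := congrArg (fun c : MulChar (ZMod q) ℂ => c x) h
    simp [hχ, MulChar.one_apply_coe] at this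
    simp only [MulChar.one_apply_coe]
    exact_mod_cast this
  have hp : (AddChar.mulShift (ZMod.stdAddChar (N := q)) k).IsPrimitive :=
    AddChar.IsPrimitive.of_ne_one (ZMod.isPrimitive_stdAddChar q hk)
  have h := gaussSum_sq h1 hq hp
  have he : fou (fun x => ((quadraticChar (ZMod q) x : ℤ) : ℂ)) k =
      gaussSum χ (AddChar.mulShift (ZMod.stdAddChar (N := q)) k) := by
    simp [fou, gaussSum, hχ, AddChar.mulShift_apply]
  rw [← he] at h
  have h3 := congrArg norm h
  have h4 : ‖χ (-1)‖ = 1 := by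
    rcases quadraticChar_dichotomy (F := ZMod q) (a := -1) (by simp) with h | h <;>
    simp [hχ, h]
  rw [norm_pow, norm_mul, h4, one_mul, ZMod.card, Complex.norm_natCast] at h3
  rw [← h3, Real.sqrt_sq (norm_nonneg _)]

theorem fou_one (k : ZMod q) : ∑ x : ZMod q, (ZMod.stdAddChar (k * x) : ℂ) =
    if k = 0 then (q : ℂ) else 0 := by
  have h := AddChar.sum_mulShift k (ZMod.isPrimitive_stdAddChar q)
  rw [ZMod.card] at h
  simp only [mul_comm k]
  rw [h]; split_ifs <;> simp

theorem exists_f (hq2 : q ≠ 2) : ∃ f : ZMod q → ℝ, (∀ x, f x = 1 ∨ f x = -1) ∧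
    ∀ k, |‖fou (fun x => (f x : ℂ)) k‖ - Real.sqrt q| ≤
      23 * (q : ℝ) ^ (1 / 4 : ℝ) * Real.sqrt (Real.log q) := by
  have hq3 : 3 ≤ q := by
    have := (Fact.out : q.Prime).two_le
    omega
  have hq3' : (3 : ℝ) ≤ q := by exact_mod_cast hq3
  have hq0 : (0 : ℝ) < q := by linarith
  set r : ℝ := (q : ℝ) ^ (1 / 4 : ℝ) with hr
  set s : ℝ := Real.sqrt q with hs
  set w : ℝ := Real.sqrt (Real.log q) with hw
  have hr1 : 1 ≤ r := Real.one_le_rpow (by linarith) (by norm_num)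
  have hs2 : s ^ 2 = q := Real.sq_sqrt hq0.le
  have hs1 : 1 ≤ s := by nlinarith [Real.sqrt_nonneg (q : ℝ)]
  have hrs : r ^ 2 = s := by
    rw [hr, hs, Real.sqrt_eq_rpow, ← Real.rpow_natCast, ← Real.rpow_mul hq0.le]
    norm_num
  have hL : 1 ≤ Real.log q := by
    rw [Real.le_log_iff_exp_le hq0]
    linarith [Real.exp_one_lt_d9]
  have hw2 : w ^ 2 = Real.log q := Real.sq_sqrt (by linarith)
  have hw1 : 1 ≤ w := by nlinarith [Real.sqrt_nonneg (Real.log (q : ℝ))]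
  have hLs : Real.log q ≤ s := by
    have h1 : Real.log q = 4 * Real.log r := by
      rw [hr, Real.log_rpow hq0]; ring
    have h2 : Real.log (r / 2) ≤ r / 2 - 1 := Real.log_le_sub_one_of_pos (by positivity)
    rw [Real.log_div (by positivity) (by norm_num)] at h2
    have h3 := Real.log_two_lt_d9
    rw [h1, ← hrs]
    nlinarith [sq_nonneg (r - 1)]
  have hwr : w ≤ r := by
    apply le_of_sq_le_sq _ (by linarith)
    rw [hw2, hrs]; exact hLs
  let N : Finset (ZMod q) := univ.filter fun x => quadraticChar (ZMod q) x = -1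
  have hN : (N.card : ℝ) ≤ q := by
    have := N.card_le_univ
    rw [ZMod.card] at this
    exact_mod_cast this
  let c : ZMod q × Bool → ZMod q → ℝ := fun j x =>
    if j.2 then (ZMod.stdAddChar (j.1 * x) : ℂ).re else (ZMod.stdAddChar (j.1 * x) : ℂ).im
  have hc : ∀ j x, |c j x| ≤ 1 := by
    intro j x
    have h1 : ‖(ZMod.stdAddChar (j.1 * x) : ℂ)‖ = 1 := AddChar.norm_apply _ _
    simp only [c]
    split_ifs
    · exact (Complex.abs_re_le_norm _).trans h1.le
    · exact (Complex.abs_im_le_norm _).trans h1.le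
  obtain ⟨T, hTN, hT⟩ := exists_subset_dev N c hc (1 / s) (w / r) (5 * (r * w)) (by positivity)
    (by rw [div_le_one (by linarith)]; exact hs1) (by positivity)
    (by rw [div_le_one (by linarith)]; exact hwr) (by
      have e1 : w / r * (5 * (r * w)) = 5 * Real.log q := by
        rw [← hw2]; field_simp
      have e2 : 1 / s * N.card * (w / r) ^ 2 ≤ Real.log q := by
        rw [div_pow, hw2, hrs]
        calc 1 / s * N.card * (Real.log q / s) ≤ 1 / s * q * (Real.log q / s) := by gcongr
          _ = Real.log q := by rw [← hs2]; field_simp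
      have e3 : Real.exp (5 * Real.log q) = (q : ℝ) ^ 5 := by
        rw [show (5 : ℝ) = ((5 : ℕ) : ℝ) by norm_num, Real.exp_nat_mul, Real.exp_log hq0]
      rw [e1, e3]
      have e4 := Real.exp_le_exp.2 e2
      rw [Real.exp_log hq0] at e4
      simp only [Fintype.card_prod, ZMod.card, Fintype.card_bool]
      push_cast
      calc 2 * ((q : ℝ) * 2) * Real.exp (1 / s * N.card * (w / r) ^ 2)
          ≤ 2 * ((q : ℝ) * 2) * q := by gcongr
        _ = 4 * (q : ℝ) ^ 2 := by ring
        _ < (q : ℝ) ^ 3 * (q : ℝ) ^ 2 := by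
            have : (3 : ℝ) ^ 3 ≤ (q : ℝ) ^ 3 := by gcongr
            have : (0 : ℝ) < (q : ℝ) ^ 2 := by positivity
            nlinarith
        _ = _ := by ring)
  let f : ZMod q → ℝ := fun x => (quadraticChar (ZMod q) x : ℝ) + (if x = 0 then 1 else 0) +
    2 * (if x ∈ T then 1 else 0)
  -- Fourier transforms of T and N
  let TT : ZMod q → ℂ := fun k => ∑ x ∈ T, ZMod.stdAddChar (k * x)
  let NN : ZMod q → ℂ := fun k => ∑ x ∈ N, ZMod.stdAddChar (k * x)
  let G : ZMod q → ℂ := fun k => fou (fun x => ((quadraticChar (ZMod q) x : ℤ) : ℂ)) k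
  have hf : ∀ k, fou (fun x => (f x : ℂ)) k = G k + 1 + 2 * TT k := by
    intro k
    have h0 : (1 : ℂ) = ∑ x : ZMod q, (if x = 0 then 1 else 0) * ZMod.stdAddChar (k * x) := by
      simp
    have hTT : TT k = ∑ x : ZMod q, (if x ∈ T then 1 else 0) * ZMod.stdAddChar (k * x) := by
      simp [TT]
    rw [h0, hTT]
    simp only [fou, f, G]
    rw [mul_sum, ← sum_add_distrib, ← sum_add_distrib]
    refine sum_congr rfl fun x _ => ?_
    split_ifs <;> push_cast <;> ring
  have hNN : ∀ k, 2 * NN k = (if k = 0 then (q : ℂ) else 0) - 1 - G k := by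
    intro k
    rw [← fou_one k]
    have h0 : (1 : ℂ) = ∑ x : ZMod q, (if x = 0 then 1 else 0) * ZMod.stdAddChar (k * x) := by
      simp
    conv_rhs => rw [h0]
    simp only [NN, G, fou, N]
    rw [sum_filter, mul_sum, ← sum_sub_distrib, ← sum_sub_distrib]
    refine sum_congr rfl fun x _ => ?_
    by_cases hx : x = 0
    · subst hx; simp
    · rcases quadraticChar_dichotomy hx with h | h
      · simp only [h, hx]
        norm_num
      · simp only [h, hx]
        norm_num
        ring
  have hdev : ∀ k, ‖TT k - (1 / s : ℝ) * NN k‖ ≤ 10 * (r * w) := by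
    intro k
    have hre := hT (k, true)
    have him := hT (k, false)
    simp only [c, if_true] at hre
    simp only [c] at him
    refine (Complex.norm_le_abs_re_add_abs_im _).trans ?_
    rw [Complex.sub_re, Complex.sub_im, Complex.re_ofReal_mul, Complex.im_ofReal_mul]
    simp only [TT, NN, Complex.re_sum, Complex.im_sum]
    simp only [Bool.false_eq_true, if_false] at him
    linarith
  have hrw : 1 ≤ r * w := by nlinarith
  refine ⟨f, ?_, ?_⟩
  · intro x
    by_cases hx : x = 0
    · subst hx
      have : (0 : ZMod q) ∉ T := fun h => by
        have := hTN h
        simp [N] at this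
      simp [f, this]
    · by_cases hxT : x ∈ T
      · have : quadraticChar (ZMod q) x = -1 := by
          have := hTN hxT
          simpa [N] using this
        left
        simp only [f, this, hx, hxT]
        norm_num
      · rcases quadraticChar_dichotomy hx with h | h
        · left; simp only [f, h, hx, hxT]; norm_num
        · right; simp only [f, h, hx, hxT]; norm_num
  · intro k
    rw [hf]
    have hd := hdev k
    have hn := hNN k
    have hs0 : (s : ℂ) ≠ 0 := by exact_mod_cast (by linarith : s ≠ 0)
    by_cases hk : k = 0
    · have hG : G k = 0 := by
        simp only [G, fou, hk, zero_mul, AddChar.map_zero_eq_one, mul_one]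
        exact_mod_cast quadraticChar_sum_zero (F := ZMod q) (by rwa [ZMod.ringChar_zmod_n])
      rw [if_pos hk, hG] at hn
      have hqs : (q : ℂ) = (s : ℂ) * s := by
        rw [← sq]; exact_mod_cast hs2.symm
      have e : G k + 1 + 2 * TT k - (s : ℂ) = 2 * (TT k - (1 / s : ℝ) * NN k) +
          ((1 - 1 / s : ℝ) : ℂ) := by
        have : 2 * ((1 / s : ℝ) * NN k : ℂ) = s - (1 / s : ℝ) := by
          rw [mul_left_comm, hn, hqs]; push_cast; field_simp; ring
        rw [mul_sub, this, hG]; push_cast; ring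
      have e1 : |‖G k + 1 + 2 * TT k‖ - s| ≤ ‖G k + 1 + 2 * TT k - (s : ℂ)‖ := by
        have := abs_norm_sub_norm_le (G k + 1 + 2 * TT k) (s : ℂ)
        rwa [Complex.norm_real, Real.norm_of_nonneg (by linarith)] at this
      refine e1.trans ?_
      rw [e]
      refine (norm_add_le _ _).trans ?_
      rw [norm_mul, Complex.norm_real, Complex.norm_two]
      have : ‖(1 - 1 / s : ℝ)‖ ≤ 1 := by
        have h1 : 1 / s ≤ 1 := by rw [div_le_one (by linarith)]; exact hs1
        have h2 : 0 < 1 / s := by positivity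
        rw [Real.norm_of_nonneg] <;> linarith
      nlinarith
    · have hG : ‖G k‖ = s := fou_quad hq2 k hk
      rw [if_neg hk] at hn
      have hn2 : ‖(2 : ℂ) * ((1 / s : ℝ) * NN k)‖ ≤ 2 := by
        rw [mul_left_comm, hn, norm_mul, Complex.norm_real, Real.norm_of_nonneg (by positivity)]
        have : ‖(0 : ℂ) - 1 - G k‖ ≤ 1 + s := by
          refine (norm_sub_le _ _).trans ?_
          rw [hG]; simp
        calc 1 / s * ‖(0 : ℂ) - 1 - G k‖ ≤ 1 / s * (2 * s) := by
              gcongr; linarith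
          _ = 2 := by field_simp
      have e1 : |‖G k + 1 + 2 * TT k‖ - s| ≤ ‖G k + 1 + 2 * TT k - G k‖ := by
        have := abs_norm_sub_norm_le (G k + 1 + 2 * TT k) (G k)
        rwa [hG] at this
      refine e1.trans ?_
      have e : G k + 1 + 2 * TT k - G k = 2 * (TT k - (1 / s : ℝ) * NN k) +
          (2 * ((1 / s : ℝ) * NN k) + 1) := by ring
      rw [e]
      refine (norm_add_le _ _).trans ?_
      have e2 := norm_add_le ((2 : ℂ) * ((1 / s : ℝ) * NN k)) 1
      rw [norm_one] at e2
      rw [norm_mul, Complex.norm_two]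
      nlinarith

end

/-- **Corollary 2.4.** There is an absolute constant `C > 0` such that for every odd prime
`q` there is a `q × q` matrix `U` with `±1` entries satisfying
`√q (1 - δ_q) ≤ s_min(U) ≤ s_max(U) ≤ √q (1 + δ_q)`, where
`δ_q = C q^{-1/4} √(log q)`. -/
theorem approx_hadamard_of_prime_size :
    ∃ C : ℝ, 0 < C ∧
      ∀ q : ℕ, q.Prime → Odd q →
        ∃ U : Matrix (Fin q) (Fin q) ℝ,
          (∀ i j, U i j = 1 ∨ U i j = -1) ∧
          Real.sqrt q * (1 - C * (q : ℝ) ^ (-(1 / 4 : ℝ)) * Real.sqrt (Real.log q))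
            ≤ sMin U ∧
          sMin U ≤ sMax U ∧
          sMax U ≤ Real.sqrt q * (1 + C * (q : ℝ) ^ (-(1 / 4 : ℝ)) * Real.sqrt (Real.log q)) := by
  refine ⟨23, by norm_num, fun q hq hodd => ?_⟩
  have : Fact q.Prime := ⟨hq⟩
  have hq2 : q ≠ 2 := by rintro rfl; exact absurd hodd (by decide)
  have hq0 : (0 : ℝ) < q := by exact_mod_cast hq.pos
  obtain ⟨f, hf1, hf2⟩ := exists_f (q := q) hq2
  have hr : Real.sqrt q * (q : ℝ) ^ (-(1 / 4 : ℝ)) = (q : ℝ) ^ (1 / 4 : ℝ) := by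
    rw [Real.sqrt_eq_rpow, ← Real.rpow_add hq0]; norm_num
  obtain ⟨U, hU, h1, h2, h3⟩ := matrix_bounds f
    (Real.sqrt q * (1 - 23 * (q : ℝ) ^ (-(1 / 4 : ℝ)) * Real.sqrt (Real.log q)))
    (Real.sqrt q * (1 + 23 * (q : ℝ) ^ (-(1 / 4 : ℝ)) * Real.sqrt (Real.log q)))
    (fun k => by
      have := (abs_le.1 (hf2 k)).1
      rw [← hr] at this
      linarith)
    (fun k => by
      have := (abs_le.1 (hf2 k)).2
      rw [← hr] at this
      linarith)
  refine ⟨U, fun i j => ?_, h1, h2, h3⟩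
  obtain ⟨x, hx⟩ := hU i j
  rw [hx]; exact hf1 x
end
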